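/- Let (X,d,μ) be a metric measure space such that for each pair of distinct points x,y ∈ X we have Mod_∞(Γ(x,y)) > 0. Then d_ess is finite-valued, and hence d_ess is a metric on X satisfying d_ess ≥ d. -/

import Mathlib

open MeasureTheory
open scoped ENNReal

/-- A *curve* in a metric space `X`: a nonconstant continuous map from a compact
interval `[a,b] ⊆ ℝ` into `X`. -/
structure Curve (X : Type*) [MetricSpace X] where
  a : ℝ
  b : ℝ
  hab : a ≤ b
  toFun : ℝ → X
  cont : ContinuousOn toFun (Set.Icc a b)
  nonconst : ∃ s ∈ Set.Icc a b, ∃ t ∈ Set.Icc a b, toFun s ≠ toFun t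

namespace Curve

variable {X : Type*} [MetricSpace X]

/-- The length of a curve: the total variation of `γ` on `[a,b]`. -/
noncomputable def length (γ : Curve X) : ℝ≥0∞ :=
  eVariationOn γ.toFun (Set.Icc γ.a γ.b)

/-- A curve is rectifiable if it has finite length. -/
def Rectifiable (γ : Curve X) : Prop := γ.length ≠ ∞

/-- The length function `s_γ(t) = length (γ|_[a,t])`. -/
noncomputable def lenFun (γ : Curve X) (t : ℝ) : ℝ :=
  (eVariationOn γ.toFun (Set.Icc γ.a t)).toReal

/-- The right inverse `s_γ⁻¹(t) = max {s ∈ [a,b] : s_γ(s) = t}` of the length function. -/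
noncomputable def lenInv (γ : Curve X) (t : ℝ) : ℝ :=
  sSup {s | s ∈ Set.Icc γ.a γ.b ∧ γ.lenFun s = t}

/-- The arc-length parametrization `γ_s(t) = γ(s_γ⁻¹(t))`. -/
noncomputable def param (γ : Curve X) (t : ℝ) : X := γ.toFun (γ.lenInv t)

/-- The parameter domain `[0, length γ]` of the arc-length parametrization,
as a subset of `ℝ` (it is all of `[0,∞)` when `γ` has infinite length). -/
def paramDomain (γ : Curve X) : Set ℝ := {t : ℝ | 0 ≤ t ∧ ENNReal.ofReal t ≤ γ.length}

/-- The line integral `∫_γ ρ ds = ∫_0^{length γ} ρ(γ_s(t)) dt` of a density `ρ` along `γ`. -/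
noncomputable def lineIntegral (γ : Curve X) (ρ : X → ℝ≥0∞) : ℝ≥0∞ :=
  ∫⁻ t in γ.paramDomain, ρ (γ.param t)

/-- `σ` is a subcurve of `γ` if it is the restriction of `γ` to a subinterval. -/
def IsSubcurve (σ γ : Curve X) : Prop :=
  γ.a ≤ σ.a ∧ σ.b ≤ γ.b ∧ ∀ t ∈ Set.Icc σ.a σ.b, σ.toFun t = γ.toFun t

/-- A curve is locally rectifiable if every interior point of its parameter interval has a
neighbourhood on which the curve is rectifiable. -/
def LocallyRectifiable (γ : Curve X) : Prop :=
  ∀ t ∈ Set.Ioo γ.a γ.b, ∃ u v : ℝ, u < t ∧ t < v ∧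
    eVariationOn γ.toFun (Set.Icc (max γ.a u) (min γ.b v)) ≠ ∞

/-- A curve has positive length in a set `F`: `m₁(γ_s⁻¹(F)) > 0`. -/
def PosLength (γ : Curve X) (F : Set X) : Prop :=
  0 < volume (γ.paramDomain ∩ γ.param ⁻¹' F)

end Curve

section Modulus

variable {X : Type*} [MetricSpace X] [MeasurableSpace X] [BorelSpace X]

/-- A density (nonnegative Borel function) `ρ` is admissible for a curve family `Γ`
if `∫_γ ρ ds ≥ 1` for every `γ ∈ Γ`. -/
def Admissible (Γ : Set (Curve X)) (ρ : X → ℝ≥0∞) : Prop :=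
  Measurable ρ ∧ ∀ γ ∈ Γ, 1 ≤ γ.lineIntegral ρ

/-- The supremum-modulus `Mod_sup(Γ) = inf {sup_X ρ : ρ ∈ Adm(Γ)}`. -/
noncomputable def ModSup (Γ : Set (Curve X)) : ℝ≥0∞ :=
  ⨅ ρ ∈ {ρ : X → ℝ≥0∞ | Admissible Γ ρ}, ⨆ x, ρ x

/-- `Mod_∞^*(Γ) = inf {‖ρ‖_∞ : ρ ∈ Adm(Γ)}`. -/
noncomputable def ModInfty (μ : Measure X) (Γ : Set (Curve X)) : ℝ≥0∞ :=
  ⨅ ρ ∈ {ρ : X → ℝ≥0∞ | Admissible Γ ρ}, essSup ρ μ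

/-- A curve family is `∞`-exceptional if `Mod_∞^*(Γ) = 0`. -/
def Exceptional (μ : Measure X) (Γ : Set (Curve X)) : Prop :=
  ModInfty μ Γ = 0

/-- `ρ` is weakly admissible for `Γ` if `∫_γ ρ ds ≥ 1` for `∞`-a.e. curve `γ ∈ Γ`. -/
def WeaklyAdmissible (μ : Measure X) (Γ : Set (Curve X)) (ρ : X → ℝ≥0∞) : Prop :=
  Measurable ρ ∧ Exceptional μ {γ ∈ Γ | γ.lineIntegral ρ < 1}

/-- The `∞`-modulus `Mod_∞(Γ) = inf {‖ρ‖_∞ : ρ weakly admissible for Γ}`. -/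
noncomputable def ModInftyW (μ : Measure X) (Γ : Set (Curve X)) : ℝ≥0∞ :=
  ⨅ ρ ∈ {ρ : X → ℝ≥0∞ | WeaklyAdmissible μ Γ ρ}, essSup ρ μ

/-- The essential length `essℓ(Γ) = sup {a ≥ 0 : Γ(a) = {γ ∈ Γ : length γ < a} is ∞-exceptional}`. -/
noncomputable def essLen (μ : Measure X) (Γ : Set (Curve X)) : ℝ≥0∞ :=
  sSup {a : ℝ≥0∞ | Exceptional μ {γ ∈ Γ | γ.length < a}}

/-- The family `Γ(x,y)` of rectifiable curves connecting `x` to `y`. -/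
def ConnCurves (x y : X) : Set (Curve X) :=
  {γ : Curve X | γ.Rectifiable ∧ γ.toFun γ.a = x ∧ γ.toFun γ.b = y}

open scoped Classical in
/-- The essential metric `d_ess(x,y) = essℓ(Γ(x,y))` for `x ≠ y`, and `0` on the diagonal. -/
noncomputable def dEss (μ : Measure X) (x y : X) : ℝ≥0∞ :=
  if x = y then 0 else essLen μ (ConnCurves x y)

end Modulus

open Set Filter Topology

/-- The variation of a continuous function of bounded variation depends continuously on the right
endpoint of the interval. -/
theorem continuousOn_toReal_eVariationOn_Icc {E : Type*} [PseudoEMetricSpace E] {f : ℝ → E}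
    {a b : ℝ} (hf : ContinuousOn f (Icc a b)) (hbv : BoundedVariationOn f (Icc a b)) :
    ContinuousOn (fun t => (eVariationOn f (Icc a t)).toReal) (Icc a b) := by
  have add : ∀ u v, a ≤ u → u ≤ v → v ≤ b →
      (eVariationOn f (Icc a v)).toReal = (eVariationOn f (Icc a u)).toReal +
        (eVariationOn f (Icc a b ∩ Icc u v)).toReal := by
    intro u v hau huv hvb
    rw [inter_eq_right.2 (Icc_subset_Icc hau hvb), ← ENNReal.toReal_add]
    · simpa using congrArg ENNReal.toReal
        (eVariationOn.Icc_add_Icc f (s := univ) hau huv (mem_univ u)).symm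
    · exact hbv.mono (Icc_subset_Icc_right (huv.trans hvb))
    · exact hbv.mono (Icc_subset_Icc hau hvb)
  intro x hx
  have lim := (hbv.tendsto_eVariationOn_Icc_zero_left
    ((hf x hx).mono inter_subset_left)).add
    (hbv.tendsto_eVariationOn_Icc_zero_right x ((hf x hx).mono inter_subset_left))
  rw [add_zero] at lim
  have lim' := (ENNReal.tendsto_toReal ENNReal.zero_ne_top).comp lim
  refine tendsto_iff_dist_tendsto_zero.2 (squeeze_zero' (.of_forall fun _ => dist_nonneg) ?_ lim')
  filter_upwards [self_mem_nhdsWithin] with y hy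
  have fin : ∀ u v, eVariationOn f (Icc a b ∩ Icc u v) ≠ ∞ := fun u v => hbv.mono inter_subset_left
  simp only [Function.comp_apply, ENNReal.toReal_add (fin _ _) (fin _ _), Real.dist_eq]
  rcases le_total y x with h | h
  · rw [add y x hy.1 h hx.2, sub_add_cancel_left, abs_neg, abs_of_nonneg ENNReal.toReal_nonneg]
    exact le_add_of_nonneg_right ENNReal.toReal_nonneg
  · rw [add x y hx.1 h hy.2, add_sub_cancel_left, abs_of_nonneg ENNReal.toReal_nonneg]
    exact le_add_of_nonneg_left ENNReal.toReal_nonneg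

namespace Curve

variable {X : Type*} [MetricSpace X] {γ σ : Curve X}

theorem Rectifiable.lenFun_add (hγ : γ.Rectifiable) {s t : ℝ} (hs : γ.a ≤ s) (hst : s ≤ t)
    (ht : t ≤ γ.b) :
    γ.lenFun s + (eVariationOn γ.toFun (Icc s t)).toReal = γ.lenFun t := by
  rw [lenFun, lenFun, ← ENNReal.toReal_add]
  · simpa using congrArg ENNReal.toReal
      (eVariationOn.Icc_add_Icc γ.toFun (s := univ) hs hst (mem_univ s))
  · exact BoundedVariationOn.mono hγ (Icc_subset_Icc_right (hst.trans ht))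
  · exact BoundedVariationOn.mono hγ (Icc_subset_Icc hs ht)

theorem Rectifiable.toFun_eq_of_lenFun_eq (hγ : γ.Rectifiable) {s t : ℝ}
    (hs : s ∈ Icc γ.a γ.b) (ht : t ∈ Icc γ.a γ.b) (h : γ.lenFun s = γ.lenFun t) :
    γ.toFun s = γ.toFun t := by
  wlog hst : s ≤ t generalizing s t
  · exact (this ht hs h.symm (le_of_not_ge hst)).symm
  have h0 : (eVariationOn γ.toFun (Icc s t)).toReal = 0 := by
    linarith [hγ.lenFun_add hs.1 hst ht.2]
  have hfin : eVariationOn γ.toFun (Icc s t) ≠ ∞ :=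
    BoundedVariationOn.mono hγ (Icc_subset_Icc hs.1 ht.2)
  have hzero := ((ENNReal.toReal_eq_zero_iff _).1 h0).resolve_right hfin
  exact edist_le_zero.1 ((eVariationOn.edist_le γ.toFun (left_mem_Icc.2 hst)
    (right_mem_Icc.2 hst)).trans hzero.le)

/-- The arc-length parametrization recovers the original curve. -/
theorem Rectifiable.param_lenFun (hγ : γ.Rectifiable) {t : ℝ} (ht : t ∈ Icc γ.a γ.b) :
    γ.param (γ.lenFun t) = γ.toFun t := by
  set S := {s | s ∈ Icc γ.a γ.b ∧ γ.lenFun s = γ.lenFun t}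
  have hbdd : BddAbove S := ⟨γ.b, fun s hs => hs.1.2⟩
  have hcl : sSup S ∈ closure S := csSup_mem_closure ⟨t, ht, rfl⟩ hbdd
  have hmem : sSup S ∈ Icc γ.a γ.b :=
    closure_minimal (fun s hs => hs.1) isClosed_Icc hcl
  have himg : γ.toFun '' S ⊆ {γ.toFun t} := by
    rintro _ ⟨s, hs, rfl⟩
    exact hγ.toFun_eq_of_lenFun_eq hs.1 ht hs.2
  have hcont : ContinuousWithinAt γ.toFun S (sSup S) :=
    (γ.cont _ hmem).mono fun s hs => hs.1
  exact closure_minimal himg isClosed_singleton (hcont.mem_closure_image hcl)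

theorem lenFun_a (γ : Curve X) : γ.lenFun γ.a = 0 := by
  simp [lenFun, eVariationOn.subsingleton]

theorem Rectifiable.exists_lenFun_eq (hγ : γ.Rectifiable) {u : ℝ}
    (hu : u ∈ Icc 0 γ.length.toReal) : ∃ t ∈ Icc γ.a γ.b, γ.lenFun t = u := by
  have := intermediate_value_Icc γ.hab (continuousOn_toReal_eVariationOn_Icc γ.cont hγ)
  exact this (by rwa [show (eVariationOn γ.toFun (Icc γ.a γ.a)).toReal = 0 from γ.lenFun_a])

theorem Rectifiable.paramDomain_eq (hγ : γ.Rectifiable) :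
    γ.paramDomain = Icc 0 γ.length.toReal := by
  ext t
  simp [paramDomain, ENNReal.ofReal_le_iff_le_toReal hγ]

theorem edist_le_length (γ : Curve X) : edist (γ.toFun γ.a) (γ.toFun γ.b) ≤ γ.length :=
  eVariationOn.edist_le _ (left_mem_Icc.2 γ.hab) (right_mem_Icc.2 γ.hab)

/-- The curve traversed backwards. -/
def reverse (γ : Curve X) : Curve X where
  a := -γ.b
  b := -γ.a
  hab := neg_le_neg γ.hab
  toFun t := γ.toFun (-t)
  cont := γ.cont.comp continuousOn_neg fun t ht => ⟨by linarith [ht.2], by linarith [ht.1]⟩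
  nonconst := by
    obtain ⟨s, hs, t, ht, h⟩ := γ.nonconst
    exact ⟨-s, ⟨by linarith [hs.2], by linarith [hs.1]⟩, -t,
      ⟨by linarith [ht.2], by linarith [ht.1]⟩, by simpa using h⟩

theorem eVariationOn_reverse_Icc (γ : Curve X) (s t : ℝ) :
    eVariationOn γ.reverse.toFun (Icc (-t) (-s)) = eVariationOn γ.toFun (Icc s t) := by
  have := eVariationOn.comp_eq_of_antitoneOn γ.toFun (fun x : ℝ => -x) (t := Icc (-t) (-s))
    (fun x _ y _ h => neg_le_neg h)
  rw [image_neg_eq_neg, neg_Icc, neg_neg, neg_neg] at this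
  exact this

theorem length_reverse (γ : Curve X) : γ.reverse.length = γ.length :=
  γ.eVariationOn_reverse_Icc γ.a γ.b

theorem Rectifiable.reverse (hγ : γ.Rectifiable) : γ.reverse.Rectifiable := by
  rwa [Rectifiable, length_reverse]

theorem Rectifiable.param_reverse (hγ : γ.Rectifiable) {u : ℝ}
    (hu : u ∈ Icc 0 γ.length.toReal) : γ.reverse.param (γ.length.toReal - u) = γ.param u := by
  obtain ⟨t, ht, rfl⟩ := hγ.exists_lenFun_eq hu
  have hlen : γ.reverse.lenFun (-t) = γ.length.toReal - γ.lenFun t := by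
    have h := hγ.lenFun_add ht.1 ht.2 le_rfl
    rw [← γ.eVariationOn_reverse_Icc] at h
    exact eq_sub_of_add_eq' h
  rw [← hlen, hγ.param_lenFun ht, hγ.reverse.param_lenFun
    ⟨neg_le_neg ht.2, neg_le_neg ht.1⟩]
  exact congrArg γ.toFun (neg_neg t)

theorem Rectifiable.lineIntegral_reverse (hγ : γ.Rectifiable) (ρ : X → ℝ≥0∞) :
    γ.reverse.lineIntegral ρ = γ.lineIntegral ρ := by
  rw [lineIntegral, lineIntegral, hγ.paramDomain_eq, hγ.reverse.paramDomain_eq, length_reverse]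
  set L := γ.length.toReal
  have himg : (fun u => L - u) '' Icc 0 L = Icc 0 L := by simp
  have h := (Measure.measurePreserving_sub_left volume L).setLIntegral_comp_emb
    (MeasurableEquiv.subLeft L).measurableEmbedding (fun u => ρ (γ.reverse.param u)) (Icc 0 L)
  rw [himg] at h
  rw [← h]
  exact setLIntegral_congr_fun measurableSet_Icc fun u hu => by
    simp only [L, hγ.param_reverse hu]

/-- The concatenation of two curves, the second one starting at the endpoint of the first. -/
noncomputable def concat (γ σ : Curve X) (h : γ.toFun γ.b = σ.toFun σ.a) : Curve X where
  a := γ.a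
  b := γ.b + (σ.b - σ.a)
  hab := by linarith [γ.hab, σ.hab]
  toFun t := if t ≤ γ.b then γ.toFun t else σ.toFun (t - γ.b + σ.a)
  cont := by
    refine ContinuousOn.if ?_ ?_ ?_
    · rintro t ⟨-, ht⟩
      have : t = γ.b := by simpa using frontier_le_subset_eq continuous_id continuous_const ht
      simp [this, h]
    · refine γ.cont.mono ?_
      rintro t ⟨ht, ht'⟩
      exact ⟨ht.1, (isClosed_Iic (a := γ.b)).closure_eq.subset ht'⟩
    · refine σ.cont.comp (by fun_prop) ?_
      rintro t ⟨ht, ht'⟩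
      have : γ.b ≤ t := closure_minimal (s := {t | ¬ t ≤ γ.b}) (t := Ici γ.b)
        (fun x hx => (not_le.1 hx).le) isClosed_Ici ht'
      exact ⟨by linarith, by linarith [ht.2]⟩
  nonconst := by
    obtain ⟨s, hs, t, ht, hne⟩ := γ.nonconst
    have := σ.hab
    refine ⟨s, ⟨hs.1, by linarith [hs.2]⟩, t, ⟨ht.1, by linarith [ht.2]⟩, ?_⟩
    simpa [hs.2, ht.2] using hne

section concat

variable (h : γ.toFun γ.b = σ.toFun σ.a)

theorem concat_toFun_left {t : ℝ} (ht : t ≤ γ.b) : (γ.concat σ h).toFun t = γ.toFun t :=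
  if_pos ht

theorem concat_toFun_right {t : ℝ} (ht : σ.a ≤ t) :
    (γ.concat σ h).toFun (γ.b + (t - σ.a)) = σ.toFun t := by
  rcases ht.eq_or_lt with rfl | ht
  · simp [concat, h]
  · simp [concat, ht]

theorem concat_toFun_b : (γ.concat σ h).toFun (γ.concat σ h).b = σ.toFun σ.b :=
  concat_toFun_right h σ.hab

theorem eVariationOn_concat_left {t : ℝ} (ht : t ≤ γ.b) :
    eVariationOn (γ.concat σ h).toFun (Icc γ.a t) = eVariationOn γ.toFun (Icc γ.a t) :=
  eVariationOn.eq_of_eqOn fun _ hs => concat_toFun_left h (hs.2.trans ht)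

theorem eVariationOn_concat_right {t : ℝ} (ht : σ.a ≤ t) :
    eVariationOn (γ.concat σ h).toFun (Icc γ.a (γ.b + (t - σ.a))) =
      γ.length + eVariationOn σ.toFun (Icc σ.a t) := by
  have hshift : eVariationOn (γ.concat σ h).toFun (Icc γ.b (γ.b + (t - σ.a))) =
      eVariationOn σ.toFun (Icc σ.a t) := by
    have himg : (fun s => γ.b - σ.a + s) '' Icc σ.a t = Icc γ.b (γ.b + (t - σ.a)) := by
      rw [image_const_add_Icc]; congr 1 <;> ring
    rw [← himg, ← eVariationOn.comp_eq_of_monotoneOn _ _ fun x _ y _ hxy => by simpa using hxy]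
    refine eVariationOn.eq_of_eqOn fun s hs => ?_
    rw [← concat_toFun_right h hs.1, Function.comp_apply]
    congr 1; ring
  have hadd := eVariationOn.Icc_add_Icc (γ.concat σ h).toFun (s := univ) γ.hab
    (show γ.b ≤ γ.b + (t - σ.a) by linarith) (mem_univ _)
  simp only [univ_inter] at hadd
  rw [← hadd, hshift, eVariationOn_concat_left h le_rfl, length]

theorem length_concat : (γ.concat σ h).length = γ.length + σ.length :=
  eVariationOn_concat_right h σ.hab

theorem Rectifiable.concat (hγ : γ.Rectifiable) (hσ : σ.Rectifiable) : (γ.concat σ h).Rectifiable := by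
  rw [Rectifiable, length_concat]
  exact ENNReal.add_ne_top.2 ⟨hγ, hσ⟩

theorem Rectifiable.param_concat_left (hγ : γ.Rectifiable) (hσ : σ.Rectifiable) {u : ℝ}
    (hu : u ∈ Icc 0 γ.length.toReal) :
    (γ.concat σ h).param u = γ.param u := by
  obtain ⟨t, ht, rfl⟩ := hγ.exists_lenFun_eq hu
  have hlen : (γ.concat σ h).lenFun t = γ.lenFun t :=
    congrArg ENNReal.toReal (eVariationOn_concat_left h ht.2)
  have hmem : t ∈ Icc (γ.concat σ h).a (γ.concat σ h).b :=
    ⟨ht.1, by have := σ.hab; simp only [Curve.concat]; linarith [ht.2]⟩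
  rw [hγ.param_lenFun ht, ← hlen, (hγ.concat h hσ).param_lenFun hmem, concat_toFun_left h ht.2]

theorem Rectifiable.param_concat_right (hγ : γ.Rectifiable) (hσ : σ.Rectifiable) {u : ℝ}
    (hu : u ∈ Icc 0 σ.length.toReal) :
    (γ.concat σ h).param (γ.length.toReal + u) = σ.param u := by
  obtain ⟨t, ht, rfl⟩ := hσ.exists_lenFun_eq hu
  have hlen : (γ.concat σ h).lenFun (γ.b + (t - σ.a)) = γ.length.toReal + σ.lenFun t := by
    rw [lenFun, lenFun, ← ENNReal.toReal_add hγ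
      (BoundedVariationOn.mono hσ (Icc_subset_Icc_right ht.2))]
    exact congrArg ENNReal.toReal (eVariationOn_concat_right h ht.1)
  have hmem : γ.b + (t - σ.a) ∈ Icc (γ.concat σ h).a (γ.concat σ h).b := by
    have := γ.hab
    simp only [Curve.concat]
    exact ⟨by linarith [ht.1], by linarith [ht.2]⟩
  rw [hσ.param_lenFun ht, ← hlen, (hγ.concat h hσ).param_lenFun hmem, concat_toFun_right h ht.1]

theorem Rectifiable.lineIntegral_concat_le (hγ : γ.Rectifiable) (hσ : σ.Rectifiable)
    (ρ : X → ℝ≥0∞) :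
    (γ.concat σ h).lineIntegral ρ ≤ γ.lineIntegral ρ + σ.lineIntegral ρ := by
  rw [lineIntegral, lineIntegral, lineIntegral, hγ.paramDomain_eq, hσ.paramDomain_eq,
    (hγ.concat h hσ).paramDomain_eq, length_concat, ENNReal.toReal_add hγ hσ]
  have himg : (fun u => γ.length.toReal + u) '' Icc 0 σ.length.toReal =
      Icc γ.length.toReal (γ.length.toReal + σ.length.toReal) := by simp [add_comm]
  rw [← Icc_union_Icc_eq_Icc (ENNReal.toReal_nonneg (a := γ.length))
    (le_add_of_nonneg_right (ENNReal.toReal_nonneg (a := σ.length)))]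
  refine (lintegral_union_le _ _ _).trans_eq (congrArg₂ _ ?_ ?_)
  · exact setLIntegral_congr_fun measurableSet_Icc fun u hu => by
      simp only [hγ.param_concat_left h hσ hu]
  · rw [← himg, ← (measurePreserving_add_left volume γ.length.toReal).setLIntegral_comp_emb
      (measurableEmbedding_addLeft _)]
    exact setLIntegral_congr_fun measurableSet_Icc fun u hu => by
      simp only [hγ.param_concat_right h hσ hu]

end concat

theorem lineIntegral_mono (γ : Curve X) {ρ ρ' : X → ℝ≥0∞} (h : ρ ≤ ρ') :
    γ.lineIntegral ρ ≤ γ.lineIntegral ρ' :=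
  lintegral_mono fun _ => h _

theorem lineIntegral_indicator_top_eq_zero {E : Set X}
    (h : γ.lineIntegral (E.indicator fun _ => ∞) < 1) :
    γ.lineIntegral (E.indicator fun _ => ∞) = 0 := by
  have htwo : 2 * γ.lineIntegral (E.indicator fun _ => ∞) =
      γ.lineIntegral (E.indicator fun _ => ∞) := by
    rw [lineIntegral, ← lintegral_const_mul' _ _ ENNReal.ofNat_ne_top]
    refine lintegral_congr fun t => ?_
    by_cases ht : γ.param t ∈ E <;> simp [ht]
  rw [two_mul] at htwo
  exact (ENNReal.add_right_inj (h.trans ENNReal.one_lt_top).ne).1 (htwo.trans (add_zero _).symm)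

end Curve

theorem essSup_indicator_top_of_measure_zero {α : Type*} [MeasurableSpace α] {μ : Measure α}
    {E : Set α} (hE : μ E = 0) :
    essSup (E.indicator fun _ => (∞ : ℝ≥0∞)) μ = 0 := by
  rw [essSup_congr_ae (indicator_meas_zero hE)]
  exact le_zero_iff.1 (essSup_le_of_ae_le _ (ae_of_all _ fun _ => le_rfl))

section Modulus

variable {X : Type*} [MetricSpace X] [MeasurableSpace X] {μ : Measure X} {Γ Γ' : Set (Curve X)}

theorem Exceptional.of_admissible (hex : Exceptional μ Γ)
    (h : ∀ ρ, Admissible Γ ρ → Admissible Γ' ρ) : Exceptional μ Γ' :=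
  le_zero_iff.1 ((biInf_mono h).trans_eq hex)

theorem Exceptional.mono (hex : Exceptional μ Γ) (h : Γ' ⊆ Γ) : Exceptional μ Γ' :=
  hex.of_admissible fun _ hρ => ⟨hρ.1, fun γ hγ => hρ.2 γ (h hγ)⟩

/-- A family of rectifiable curves is `∞`-exceptional if and only if the infinite density on some
Borel null set is admissible for it. -/
theorem exceptional_iff_exists_null (hΓ : ∀ γ ∈ Γ, γ.Rectifiable) :
    Exceptional μ Γ ↔ ∃ E, MeasurableSet E ∧ μ E = 0 ∧
      Admissible Γ (E.indicator fun _ => ∞) := by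
  constructor
  · intro hex
    have hρ : ∀ n : ℕ, ∃ ρ, Admissible Γ ρ ∧ essSup ρ μ < (n + 1 : ℝ≥0∞)⁻¹ := by
      intro n
      have : ModInfty μ Γ < (n + 1 : ℝ≥0∞)⁻¹ := by
        rw [show ModInfty μ Γ = 0 from hex]
        exact ENNReal.inv_pos.2 (by simp)
      simpa [ModInfty, iInf_lt_iff] using this
    choose ρ hadm hsup using hρ
    have hE : MeasurableSet (⋃ n : ℕ, {x | (n + 1 : ℝ≥0∞)⁻¹ < ρ n x}) :=
      .iUnion fun n => measurableSet_lt measurable_const (hadm n).1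
    refine ⟨_, hE, measure_iUnion_null fun n => ?_, measurable_const.indicator hE, ?_⟩
    · have := ae_iff.1 (ae_lt_of_essSup_lt (hsup n))
      exact measure_mono_null (fun x hx => not_lt.2 (le_of_lt (mem_ofPred.1 hx))) this
    · intro γ hγ
      set E := ⋃ n : ℕ, {x | (n + 1 : ℝ≥0∞)⁻¹ < ρ n x}
      have hbound : ∀ n : ℕ, 1 ≤ (n + 1 : ℝ≥0∞)⁻¹ * volume γ.paramDomain +
          γ.lineIntegral (E.indicator fun _ => ∞) := by
        intro n
        rw [← setLIntegral_const, Curve.lineIntegral, ← lintegral_add_left measurable_const]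
        refine ((hadm n).2 γ hγ).trans (lintegral_mono fun t => ?_)
        by_cases ht : (n + 1 : ℝ≥0∞)⁻¹ < ρ n (γ.param t)
        · have : γ.param t ∈ E := mem_iUnion.2 ⟨n, ht⟩
          simp [this]
        · exact (not_lt.1 ht).trans le_self_add
      have hvol : volume γ.paramDomain ≠ ∞ := by
        rw [(hΓ γ hγ).paramDomain_eq]
        exact measure_Icc_lt_top.ne
      have hinv : Tendsto (fun n : ℕ => (n + 1 : ℝ≥0∞)⁻¹) atTop (𝓝 0) := by
        simpa using (tendsto_add_atTop_iff_nat 1).2 ENNReal.tendsto_inv_nat_nhds_zero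
      have hlim := (ENNReal.Tendsto.mul_const hinv (.inr hvol)).add_const
        (γ.lineIntegral (E.indicator fun _ => ∞))
      rw [zero_mul, zero_add] at hlim
      exact ge_of_tendsto' hlim hbound
  · rintro ⟨E, -, hE, hadm⟩
    exact le_zero_iff.1 ((iInf₂_le _ hadm).trans_eq (essSup_indicator_top_of_measure_zero hE))

/-- A countable union of `∞`-exceptional families of rectifiable curves is `∞`-exceptional. -/
theorem Exceptional.iUnion {Γ : ℕ → Set (Curve X)} (hΓ : ∀ n, ∀ γ ∈ Γ n, γ.Rectifiable)
    (hex : ∀ n, Exceptional μ (Γ n)) : Exceptional μ (⋃ n, Γ n) := by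
  choose E hE hnull hadm using fun n => (exceptional_iff_exists_null (hΓ n)).1 (hex n)
  have hrect : ∀ γ ∈ ⋃ n, Γ n, γ.Rectifiable := fun γ hγ =>
    let ⟨n, hn⟩ := mem_iUnion.1 hγ
    hΓ n γ hn
  refine (exceptional_iff_exists_null hrect).2 ⟨⋃ n, E n, .iUnion hE, measure_iUnion_null hnull,
    measurable_const.indicator (.iUnion hE), fun γ hγ => ?_⟩
  obtain ⟨n, hn⟩ := mem_iUnion.1 hγ
  refine ((hadm n).2 γ hn).trans (γ.lineIntegral_mono ?_)
  exact indicator_le_indicator_of_subset (subset_iUnion E n) fun _ => zero_le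

theorem exceptional_of_lt_essLen {a : ℝ≥0∞} (ha : a < essLen μ Γ) :
    Exceptional μ {γ ∈ Γ | γ.length < a} := by
  obtain ⟨b, hb, hab⟩ := lt_sSup_iff.1 ha
  exact Exceptional.mono hb fun γ hγ => ⟨hγ.1, hγ.2.trans hab⟩

theorem not_exceptional_of_essLen_lt {a : ℝ≥0∞} (ha : essLen μ Γ < a) :
    ¬ Exceptional μ {γ ∈ Γ | γ.length < a} := fun h =>
  (le_sSup (a := a) h).not_gt ha

theorem exceptional_empty : Exceptional μ (∅ : Set (Curve X)) :=
  (exceptional_iff_exists_null (by simp)).2 ⟨∅, .empty, measure_empty,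
    measurable_const.indicator .empty, by simp⟩

theorem dEss_of_ne {x y : X} (h : x ≠ y) : dEss μ x y = essLen μ (ConnCurves x y) :=
  if_neg h

theorem dEss_self (x : X) : dEss μ x x = 0 :=
  if_pos rfl

theorem edist_le_dEss (x y : X) : edist x y ≤ dEss μ x y := by
  rcases eq_or_ne x y with rfl | h
  · simp
  rw [dEss_of_ne h]
  refine le_sSup (exceptional_empty.mono ?_)
  rintro γ ⟨⟨-, rfl, rfl⟩, hγ⟩
  exact absurd γ.edist_le_length (not_le.2 hγ)

theorem dEss_eq_zero_iff {x y : X} : dEss μ x y = 0 ↔ x = y :=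
  ⟨fun h => edist_le_zero.1 ((edist_le_dEss x y).trans_eq h), fun h => h ▸ dEss_self x⟩

theorem essLen_connCurves_le_swap (x y : X) :
    essLen μ (ConnCurves x y) ≤ essLen μ (ConnCurves y x) := by
  refine sSup_le_sSup fun a ha => Exceptional.of_admissible ha fun ρ hρ => ⟨hρ.1, ?_⟩
  rintro γ ⟨⟨hγ, rfl, rfl⟩, hlen⟩
  rw [← hγ.lineIntegral_reverse]
  refine hρ.2 _ ⟨⟨hγ.reverse, ?_, ?_⟩, by rwa [Curve.length_reverse]⟩
  · exact congrArg γ.toFun (neg_neg _)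
  · exact congrArg γ.toFun (neg_neg _)

theorem dEss_comm (x y : X) : dEss μ x y = dEss μ y x := by
  rcases eq_or_ne x y with rfl | h
  · rfl
  rw [dEss_of_ne h, dEss_of_ne h.symm]
  exact (essLen_connCurves_le_swap x y).antisymm (essLen_connCurves_le_swap y x)

theorem exists_lineIntegral_eq_zero_of_essLen_lt {x y : X} {a : ℝ≥0∞}
    (ha : essLen μ (ConnCurves x y) < a) {E : Set X} (hE : MeasurableSet E) (hnull : μ E = 0) :
    ∃ γ ∈ ConnCurves x y, γ.length < a ∧ γ.lineIntegral (E.indicator fun _ => ∞) = 0 := by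
  by_contra! hcon
  refine not_exceptional_of_essLen_lt ha ((exceptional_iff_exists_null fun γ hγ => hγ.1.1).2
    ⟨E, hE, hnull, measurable_const.indicator hE, fun γ hγ => ?_⟩)
  by_contra! hlt
  exact hcon γ hγ.1 hγ.2 (Curve.lineIntegral_indicator_top_eq_zero hlt)

theorem essLen_connCurves_triangle (x y z : X) :
    essLen μ (ConnCurves x y) ≤ essLen μ (ConnCurves x z) + essLen μ (ConnCurves z y) := by
  by_contra! hlt
  have hadd : ∃ r s, essLen μ (ConnCurves x z) < r ∧ essLen μ (ConnCurves z y) < s ∧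
      r + s < essLen μ (ConnCurves x y) := by
    obtain ⟨d, hd, hd'⟩ := exists_between hlt
    obtain ⟨ε, hε, hd''⟩ := ENNReal.lt_iff_exists_add_pos_lt.1 hd
    have hfin := ENNReal.add_ne_top.1 (ne_top_of_lt hlt)
    have hε2 : ((ε / 2 : NNReal) : ℝ≥0∞) ≠ 0 := by simpa using hε.ne'
    refine ⟨_, _, ENNReal.lt_add_right hfin.1 hε2, ENNReal.lt_add_right hfin.2 hε2, ?_⟩
    rw [add_add_add_comm, ← ENNReal.coe_add, add_halves]
    exact hd''.trans hd'
  obtain ⟨r, s, hr, hs, hrs⟩ := hadd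
  obtain ⟨E, hE, hnull, hadm⟩ := (exceptional_iff_exists_null fun γ hγ => hγ.1.1).1
    (exceptional_of_lt_essLen hrs)
  obtain ⟨γ, ⟨hγ, hγa, hγb⟩, hγr, hγ0⟩ := exists_lineIntegral_eq_zero_of_essLen_lt hr hE hnull
  obtain ⟨σ, ⟨hσ, hσa, hσb⟩, hσs, hσ0⟩ := exists_lineIntegral_eq_zero_of_essLen_lt hs hE hnull
  have h : γ.toFun γ.b = σ.toFun σ.a := hγb.trans hσa.symm
  have hle := hγ.lineIntegral_concat_le h hσ (E.indicator fun _ => ∞)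
  rw [hγ0, hσ0, add_zero] at hle
  have hmem : γ.concat σ h ∈ {τ ∈ ConnCurves x y | τ.length < r + s} :=
    ⟨⟨hγ.concat h hσ, (Curve.concat_toFun_left h γ.hab).trans hγa,
      (Curve.concat_toFun_b h).trans hσb⟩,
      by rw [Curve.length_concat]; exact ENNReal.add_lt_add hγr hσs⟩
  exact absurd ((hadm.2 _ hmem).trans hle) (by simp)

theorem dEss_triangle (x y z : X) : dEss μ x y ≤ dEss μ x z + dEss μ z y := by
  rcases eq_or_ne x y with rfl | hxy
  · simp [dEss_self]
  rcases eq_or_ne x z with rfl | hxz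
  · simp [dEss_self]
  rcases eq_or_ne z y with rfl | hzy
  · simp [dEss_self]
  rw [dEss_of_ne hxy, dEss_of_ne hxz, dEss_of_ne hzy]
  exact essLen_connCurves_triangle x y z

theorem modInftyW_eq_zero_of_exceptional (hex : Exceptional μ Γ) : ModInftyW μ Γ = 0 := by
  have hw : WeaklyAdmissible μ Γ ((∅ : Set X).indicator fun _ => ∞) :=
    ⟨measurable_const.indicator .empty, hex.mono fun γ hγ => hγ.1⟩
  exact le_zero_iff.1 ((iInf₂_le _ hw).trans_eq (essSup_indicator_top_of_measure_zero
    measure_empty))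

theorem essLen_lt_top_of_modInftyW_pos (hΓ : ∀ γ ∈ Γ, γ.Rectifiable)
    (hpos : 0 < ModInftyW μ Γ) : essLen μ Γ < ∞ := by
  by_contra htop
  rw [not_lt_top_iff] at htop
  have hunion : Exceptional μ (⋃ n : ℕ, {γ ∈ Γ | γ.length < n}) :=
    .iUnion (fun n γ hγ => hΓ γ hγ.1) fun n =>
      exceptional_of_lt_essLen (htop ▸ ENNReal.natCast_lt_top n)
  refine hpos.ne' (modInftyW_eq_zero_of_exceptional (hunion.mono fun γ hγ => ?_))
  obtain ⟨n, hn⟩ := ENNReal.exists_nat_gt (hΓ γ hγ)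
  exact mem_iUnion.2 ⟨n, hγ, hn⟩

end Modulus

/-- If `Mod_∞(Γ(x,y)) > 0` for every pair of distinct points `x, y`, then `d_ess` is
finite-valued, and hence is a metric on `X` satisfying `d_ess ≥ d`. -/
theorem dEss_metric_of_modInftyW_pos {X : Type*} [MetricSpace X] [TopologicalSpace.SeparableSpace X]
    [MeasurableSpace X] [BorelSpace X] (μ : Measure X)
    (hμ : ∀ x : X, ∃ r > 0, 0 < μ (Metric.ball x r) ∧ μ (Metric.ball x r) < ∞)
    (hpos : ∀ x y : X, x ≠ y → 0 < ModInftyW μ (ConnCurves x y)) :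
    (∀ x y : X, dEss μ x y < ∞) ∧
    (∀ x y : X, dEss μ x y = 0 ↔ x = y) ∧
    (∀ x y : X, dEss μ x y = dEss μ y x) ∧
    (∀ a b c : X, dEss μ a b ≤ dEss μ a c + dEss μ c b) ∧
    (∀ x y : X, edist x y ≤ dEss μ x y) := by
  refine ⟨fun x y => ?_, fun _ _ => dEss_eq_zero_iff, dEss_comm, fun a b c => dEss_triangle a b c,
    edist_le_dEss⟩
  rcases eq_or_ne x y with rfl | h
  · simp [dEss_self]
  · rw [dEss_of_ne h]
    exact essLen_lt_top_of_modInftyW_pos (fun γ hγ => hγ.1) (hpos x y h)
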